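/- Let H = B₃/⟪(σ₁σ₂σ₁)²⟫, the quotient of the braid group B₃ by the normal closure of (σ₁σ₂σ₁)², with distinguished element the image of σ₁. Then the automorphism τ of A(H, σ₁) satisfies τ² − τ + id = 0, so that A(H, σ₁) is a module over Λ = ℤ[t]/(t² − t + 1) with t acting as τ, and this Λ-module is free of rank 1, generated by the class of σ₂σ₁⁻¹. -/

import Mathlib

namespace Sextics

/-- The braid group `B₃ = ⟨σ₁, σ₂ | σ₁σ₂σ₁ = σ₂σ₁σ₂⟩`. -/
def relsB3 : Set (FreeGroup (Fin 2)) :=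
  {FreeGroup.of 0 * FreeGroup.of 1 * FreeGroup.of 0 *
      (FreeGroup.of 1 * FreeGroup.of 0 * FreeGroup.of 1)⁻¹}

abbrev B3 := PresentedGroup relsB3

def σ1 : B3 := PresentedGroup.of 0
def σ2 : B3 := PresentedGroup.of 1

/-- The quotient `B₃/⟪(σ₁σ₂σ₁)²⟫`. -/
abbrev Q3 := B3 ⧸ Subgroup.normalClosure ({(σ1 * σ2 * σ1) ^ 2} : Set B3)

def q1 : Q3 := QuotientGroup.mk σ1
def q2 : Q3 := QuotientGroup.mk σ2

/-- Conjugation by `g` restricted to the commutator subgroup `G′`. -/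
def conjSub {G : Type*} [Group G] (g : G) : ↥(commutator G) →* ↥(commutator G) where
  toFun x := ⟨g * (x : G) * g⁻¹, Subgroup.Normal.conj_mem inferInstance (x : G) x.2 g⟩
  map_one' := by ext; simp
  map_mul' x y := by ext; simp [mul_assoc]

/-- The Alexander module `A(G, g) = G′/G″` of a group `G`, written additively.  (The
distinguished element `g` enters through the automorphism `tau g` below.) -/
abbrev AlexMod (G : Type*) [Group G] := Additive (Abelianization ↥(commutator G))

/-- The automorphism `τ` of `A(G, g)` induced by conjugation by `g`: `τ[x] = [g x g⁻¹]`. -/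
def tau {G : Type*} [Group G] (g : G) : AlexMod G → AlexMod G :=
  fun x => Additive.ofMul (Abelianization.map (conjSub g) (Additive.toMul x))

/-- The class in `A(G, g)` of an element of the derived subgroup. -/
def cls {G : Type*} [Group G] {w : G} (h : w ∈ commutator G) : AlexMod G :=
  Additive.ofMul (Abelianization.of (⟨w, h⟩ : ↥(commutator G)))

/-- The ring `Λ = ℤ[t]/(t² − t + 1)`. -/
abbrev Lam :=
  Polynomial ℤ ⧸ Ideal.span ({Polynomial.X ^ 2 - Polynomial.X + 1} : Set (Polynomial ℤ))

/-- The class `t ∈ Λ`. -/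
noncomputable def tL : Lam := Ideal.Quotient.mk _ Polynomial.X

/-- The scalar multiplication of an explicitly given module structure. -/
def smulOf {R M : Type*} [Semiring R] [AddCommMonoid M] (inst : Module R M)
    (r : R) (m : M) : M :=
  @SMul.smul R M inst.toDistribMulAction.toMulAction.toSMul r m

end Sextics

open Sextics

namespace Sextics

/-! ### Generators of the derived subgroup -/

section BraidRelation

variable {G : Type*} [Group G]

lemma conj_conj_of_braid {a b : G} (h : a * b * a = b * a * b) :
    a * (a * (b * a⁻¹) * a⁻¹) * a⁻¹ = (b * a⁻¹)⁻¹ * (a * (b * a⁻¹) * a⁻¹) := by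
  have h' : a * b * a⁻¹ = b⁻¹ * a * b := by
    rw [mul_inv_eq_iff_eq_mul, mul_assoc, mul_assoc, eq_inv_mul_iff_mul_eq]
    simpa only [mul_assoc] using h.symm
  calc a * (a * (b * a⁻¹) * a⁻¹) * a⁻¹ = a * (a * b * a⁻¹) * a⁻¹ * a⁻¹ := by group
    _ = a * (b⁻¹ * a * b) * a⁻¹ * a⁻¹ := by rw [h']
    _ = _ := by group

/-- A subgroup is normal as soon as a generating set conjugates it into itself, together with
the inverses of the generators. -/
lemma normal_of_conj_mem_of_closure_eq_top {N : Subgroup G} {S : Set G}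
    (hS : Subgroup.closure S = ⊤) (h : ∀ s ∈ S, ∀ n ∈ N, s * n * s⁻¹ ∈ N)
    (h' : ∀ s ∈ S, ∀ n ∈ N, s⁻¹ * n * s ∈ N) : N.Normal := by
  refine ⟨fun n hn g => ?_⟩
  have hg : g ∈ Subgroup.closure S := hS ▸ Subgroup.mem_top g
  induction hg using Subgroup.closure_induction'' generalizing n with
  | mem s hs => exact h s hs n hn
  | inv_mem s hs => simpa using h' s hs n hn
  | one => simpa using hn
  | mul x y _ _ hx hy => simpa [mul_assoc] using hx _ (hy n hn)

/-- In a group generated by two elements `a`, `b` satisfying the braid relation, the derived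
subgroup is generated by `b * a⁻¹` and its conjugate by `a`. -/
lemma commutator_le_closure_of_braid {a b : G} (h : a * b * a = b * a * b)
    (hab : Subgroup.closure {a, b} = ⊤) :
    commutator G ≤ Subgroup.closure {b * a⁻¹, a * (b * a⁻¹) * a⁻¹} := by
  set u := b * a⁻¹ with hu
  set v := a * u * a⁻¹ with hv
  set N := Subgroup.closure {u, v} with hN
  have huN : u ∈ N := Subgroup.subset_closure (by simp)
  have hvN : v ∈ N := Subgroup.subset_closure (by simp)
  have hvv : a * v * a⁻¹ = u⁻¹ * v := conj_conj_of_braid h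
  have hb : b = u * a := by simp [hu]
  have conj_le (c : G) (hcu : c * u * c⁻¹ ∈ N) (hcv : c * v * c⁻¹ ∈ N) :
      ∀ n ∈ N, c * n * c⁻¹ ∈ N := by
    have : N ≤ N.comap (MulAut.conj c).toMonoidHom := by
      rw [hN, Subgroup.closure_le]
      rintro x (rfl | rfl)
      · simpa using hcu
      · simpa using hcv
    intro n hn
    simpa using this hn
  have ha : ∀ n ∈ N, a * n * a⁻¹ ∈ N :=
    conj_le a hvN (hvv ▸ N.mul_mem (N.inv_mem huN) hvN)
  have ha' : ∀ n ∈ N, a⁻¹ * n * a ∈ N := by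
    have hv' : a⁻¹ * v * a = u := by rw [hv]; group
    have hu' : a⁻¹ * u * a = u * v⁻¹ := by
      have : u = v * (a * v * a⁻¹)⁻¹ := by rw [hvv]; group
      calc a⁻¹ * u * a = a⁻¹ * (v * (a * v * a⁻¹)⁻¹) * a := by rw [← this]
        _ = (a⁻¹ * v * a) * v⁻¹ := by group
        _ = u * v⁻¹ := by rw [hv']
    have := conj_le a⁻¹ (by simpa [hu'] using N.mul_mem huN (N.inv_mem hvN))
      (by simpa [hv'] using huN)
    simpa using this
  have hnormal : N.Normal := by
    refine normal_of_conj_mem_of_closure_eq_top hab ?_ ?_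
    · rintro s (rfl | rfl) n hn
      · exact ha n hn
      · have := N.mul_mem (N.mul_mem huN (ha n hn)) (N.inv_mem huN)
        rw [hb]
        simpa [mul_assoc] using this
    · rintro s (rfl | rfl) n hn
      · exact ha' n hn
      · have := ha' _ (N.mul_mem (N.mul_mem (N.inv_mem huN) hn) huN)
        rw [hb]
        simpa [mul_assoc] using this
  have hcomm : ∀ x y : G, x * y * x⁻¹ * y⁻¹ ∈ N := by
    have hbar : (QuotientGroup.mk b : G ⧸ N) = QuotientGroup.mk a := by
      rw [eq_comm, QuotientGroup.eq]
      have := ha' u huN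
      rwa [hu, mul_assoc, inv_mul_cancel_right] at this
    have hz : ∀ x : G, (QuotientGroup.mk x : G ⧸ N) ∈
        Subgroup.zpowers (QuotientGroup.mk a : G ⧸ N) := by
      have : (⊤ : Subgroup G) ≤
          (Subgroup.zpowers (QuotientGroup.mk a : G ⧸ N)).comap (QuotientGroup.mk' N) := by
        rw [← hab, Subgroup.closure_le]
        rintro x (rfl | rfl)
        · exact Subgroup.mem_zpowers _
        · rw [Subgroup.coe_comap, Set.mem_preimage, QuotientGroup.mk'_apply, hbar]
          exact Subgroup.mem_zpowers _
      exact fun x => this (Subgroup.mem_top x)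
    intro x y
    rw [← QuotientGroup.eq_one_iff]
    obtain ⟨m, hm⟩ := hz x
    obtain ⟨n, hn⟩ := hz y
    simp only at hm hn
    rw [QuotientGroup.mk_mul, QuotientGroup.mk_mul, QuotientGroup.mk_mul, QuotientGroup.mk_inv,
      QuotientGroup.mk_inv, ← hm, ← hn]
    group
  rw [commutator_def, Subgroup.commutator_le]
  intro x _ y _
  exact hcomm x y

end BraidRelation

lemma mul_inv_mem_commutator_of_braid {G : Type*} [Group G] {a b : G}
    (h : a * b * a = b * a * b) : b * a⁻¹ ∈ commutator G := by
  have : b * a⁻¹ = a * b * a * (a * b)⁻¹ * a⁻¹ := by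
    rw [h]
    group
  rw [this]
  exact Subgroup.commutator_mem_commutator (Subgroup.mem_top _) (Subgroup.mem_top _)

lemma σ_braid : σ1 * σ2 * σ1 = σ2 * σ1 * σ2 :=
  mul_inv_eq_one.mp (PresentedGroup.one_of_mem (rels := relsB3) rfl)

lemma q_braid : q1 * q2 * q1 = q2 * q1 * q2 :=
  congrArg (QuotientGroup.mk (s := Subgroup.normalClosure ({(σ1 * σ2 * σ1) ^ 2} : Set B3))) σ_braid

lemma closure_q : Subgroup.closure {q1, q2} = (⊤ : Subgroup Q3) := by
  have h := congrArg (Subgroup.map (QuotientGroup.mk'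
    (Subgroup.normalClosure ({(σ1 * σ2 * σ1) ^ 2} : Set B3))))
    (PresentedGroup.closure_range_of relsB3)
  rw [MonoidHom.map_closure, Subgroup.map_top_of_surjective _ (QuotientGroup.mk'_surjective _),
    ← Set.range_comp] at h
  rw [← h]
  refine congrArg _ (Set.ext fun x => ?_)
  rw [Set.mem_range, Fin.exists_fin_two, Set.mem_insert_iff, Set.mem_singleton_iff,
    eq_comm (a := x), eq_comm (a := x)]
  rfl

lemma q_mem : q2 * q1⁻¹ ∈ commutator Q3 := mul_inv_mem_commutator_of_braid q_braid

/-! ### The automorphism `tau` as an additive endomorphism -/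

/-- The automorphism `tau g` as an endomorphism of the additive group `AlexMod G`. -/
def tauEnd {G : Type*} [Group G] (g : G) : AddMonoid.End (AlexMod G) :=
  MonoidHom.toAdditive (Abelianization.map (conjSub g))

lemma tauEnd_apply {G : Type*} [Group G] (g : G) (x : AlexMod G) : tauEnd g x = tau g x := rfl

lemma tau_cls {G : Type*} [Group G] (g : G) {w : G} (h : w ∈ commutator G) :
    tau g (cls h) = cls (Subgroup.Normal.conj_mem inferInstance w h g) := rfl

lemma cls_congr {G : Type*} [Group G] {v w : G} (hv : v ∈ commutator G) (h : v = w) :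
    cls hv = cls (h ▸ hv) := by
  subst h; rfl

/-- The class of `σ₂σ₁⁻¹` and its image under `tau q1` generate `AlexMod Q3`. -/
lemma addSubgroup_eq_top {K : AddSubgroup (AlexMod Q3)} (h : cls q_mem ∈ K)
    (h' : tau q1 (cls q_mem) ∈ K) : K = ⊤ := by
  have key : ∀ w (_ : w ∈ Subgroup.closure {q2 * q1⁻¹, q1 * (q2 * q1⁻¹) * q1⁻¹}),
      ∃ hw : w ∈ commutator Q3, cls hw ∈ K := by
    intro w hw
    induction hw using Subgroup.closure_induction with
    | mem x hx =>
      rcases hx with rfl | rfl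
      · exact ⟨_, h⟩
      · exact ⟨_, h'⟩
    | one => exact ⟨one_mem _, K.zero_mem⟩
    | mul x y _ _ hx hy =>
      obtain ⟨hx, hx'⟩ := hx
      obtain ⟨hy, hy'⟩ := hy
      exact ⟨mul_mem hx hy, K.add_mem hx' hy'⟩
    | inv x _ hx =>
      obtain ⟨hx, hx'⟩ := hx
      exact ⟨inv_mem hx, K.neg_mem hx'⟩
  rw [eq_top_iff]
  intro x _
  obtain ⟨⟨w, hw⟩, rfl⟩ := QuotientGroup.mk_surjective x
  exact (key w (commutator_le_closure_of_braid q_braid closure_q hw)).2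

lemma tau_tau_cls : tau q1 (tau q1 (cls q_mem)) = -cls q_mem + tau q1 (cls q_mem) := by
  rw [tau_cls, tau_cls, cls_congr _ (conj_conj_of_braid q_braid)]
  rfl

lemma tauEnd_relation : tauEnd q1 ^ 2 - tauEnd q1 + 1 = 0 := by
  have hu : (tauEnd q1 ^ 2 - tauEnd q1 + 1 : AddMonoid.End (AlexMod Q3)) (cls q_mem) = 0 := by
    change tau q1 (tau q1 (cls q_mem)) - tau q1 (cls q_mem) + cls q_mem = 0
    rw [tau_tau_cls]
    abel
  have hker : (tauEnd q1 ^ 2 - tauEnd q1 + 1 : AddMonoid.End (AlexMod Q3)).ker = ⊤ := by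
    refine addSubgroup_eq_top hu ?_
    have hcomm : (tauEnd q1 ^ 2 - tauEnd q1 + 1) * tauEnd q1 =
        tauEnd q1 * (tauEnd q1 ^ 2 - tauEnd q1 + 1) := by
      simp only [add_mul, sub_mul, mul_add, mul_sub, pow_two, mul_assoc, one_mul, mul_one]
    have := DFunLike.congr_fun hcomm (cls q_mem)
    exact this.trans ((congrArg (tauEnd q1) hu).trans (map_zero _))
  ext x
  exact (AddMonoidHom.mem_ker (f := (tauEnd q1 ^ 2 - tauEnd q1 + 1 :
    AddMonoid.End (AlexMod Q3)))).mp (hker ▸ AddSubgroup.mem_top x)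

/-- The action of `Λ` on `AlexMod Q3` in which `t` acts as `tau q1`. -/
noncomputable def lamAction : Lam →+* AddMonoid.End (AlexMod Q3) :=
  Ideal.Quotient.lift _ (Polynomial.aeval (R := ℤ) (tauEnd q1)).toRingHom fun p hp => by
    have : Ideal.span {Polynomial.X ^ 2 - Polynomial.X + 1} ≤
        RingHom.ker (Polynomial.aeval (R := ℤ) (tauEnd q1)).toRingHom := by
      rw [Ideal.span_singleton_le_iff_mem, RingHom.mem_ker]
      simpa using tauEnd_relation
    exact this hp

lemma lamAction_tL : lamAction tL = tauEnd q1 := by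
  simp [lamAction, tL]

/-- To prove a property of every element of `Λ`, prove it for `1` and show that it is stable
under addition, negation and multiplication by `t`. -/
lemma lam_induction {p : Lam → Prop} (one : p 1) (hadd : ∀ r s, p r → p s → p (r + s))
    (neg : ∀ r, p r → p (-r)) (mul : ∀ r, p r → p (tL * r)) (r : Lam) : p r := by
  have zero : p 0 := by simpa using hadd 1 (-1) one (neg 1 one)
  have nat : ∀ n : ℕ, p n := fun n => by
    induction n with
    | zero => simpa using zero
    | succ n ih => simpa using hadd _ _ ih one
  have int : ∀ n : ℤ, p n := fun n => by
    obtain ⟨m, rfl | rfl⟩ := n.eq_nat_or_neg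
    · simpa using nat m
    · simpa using neg _ (nat m)
  have pow : ∀ (n : ℕ) (m : ℤ), p (tL ^ n * m) := fun n m => by
    induction n with
    | zero => simpa using int m
    | succ n ih => simpa [pow_succ', mul_assoc] using mul _ ih
  obtain ⟨f, rfl⟩ := Ideal.Quotient.mk_surjective r
  induction f using Polynomial.induction_on' with
  | add f g hf hg => simpa using hadd _ _ hf hg
  | monomial n a =>
    rw [← Polynomial.C_mul_X_pow_eq_monomial, mul_comm]
    simpa [tL] using pow n a

/-! ### The representation by affine maps of `Λ` -/

lemma tL_relation : tL ^ 2 - tL + 1 = 0 :=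
  Ideal.Quotient.eq_zero_iff_mem.mpr (Ideal.mem_span_singleton_self _)

/-- The unit `t` of `Λ`, with inverse `1 - t`. -/
noncomputable def tUnit : Lamˣ where
  val := tL
  inv := 1 - tL
  val_inv := by linear_combination -tL_relation
  inv_val := by linear_combination -tL_relation

/-- The action of the units of a ring on its additive group by multiplication. -/
def unitsMulAut (R : Type*) [CommRing R] : Rˣ →* MulAut (Multiplicative R) :=
  (MulAutMultiplicative R).symm.toMonoidHom.comp (DistribMulAction.toAddAut Rˣ R)

lemma unitsMulAut_apply {R : Type*} [CommRing R] (c : Rˣ) (x : Multiplicative R) :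
    unitsMulAut R c x = Multiplicative.ofAdd ((c : R) * x.toAdd) := rfl

/-- The group of affine maps `x ↦ c * x + b` of a commutative ring. -/
abbrev AffineGroup (R : Type*) [CommRing R] := Multiplicative R ⋊[unitsMulAut R] Rˣ

/-- The affine maps `x ↦ c * x` and `x ↦ c * x + 1` of a commutative ring. -/
def affGen {R : Type*} [CommRing R] (c : Rˣ) : Fin 2 → AffineGroup R :=
  ![⟨1, c⟩, ⟨Multiplicative.ofAdd 1, c⟩]

lemma affGen_braid {R : Type*} [CommRing R] {c : Rˣ} (hc : (c : R) ^ 2 - c + 1 = 0) :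
    affGen c 0 * affGen c 1 * affGen c 0 = affGen c 1 * affGen c 0 * affGen c 1 := by
  ext
  · simp [affGen, unitsMulAut_apply]
    linear_combination -hc
  · simp [affGen]

lemma affGen_sq {R : Type*} [CommRing R] {c : Rˣ} (hc : (c : R) ^ 2 - c + 1 = 0) :
    (affGen c 0 * affGen c 1 * affGen c 0) ^ 2 = 1 := by
  rw [pow_two]
  ext
  · simp [affGen, unitsMulAut_apply]
    linear_combination ((c : R) * (c + 1)) * hc
  · simp [affGen]
    linear_combination ((c : R) ^ 4 + c ^ 3 - c - 1) * hc

/-- The representation of `B3` by affine maps of `Λ`. -/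
noncomputable def affRepB3 : B3 →* AffineGroup Lam :=
  PresentedGroup.toGroup (f := affGen tUnit) (rels := relsB3) (by
    rintro r rfl
    rw [map_mul, map_inv, mul_inv_eq_one]
    simpa only [map_mul, FreeGroup.lift_apply_of] using affGen_braid (c := tUnit) tL_relation)

lemma affRepB3_σ1 : affRepB3 σ1 = affGen tUnit 0 := PresentedGroup.toGroup.of (rels := relsB3) _

lemma affRepB3_σ2 : affRepB3 σ2 = affGen tUnit 1 := PresentedGroup.toGroup.of (rels := relsB3) _

/-- The representation of `Q3` by affine maps of `Λ`. -/
noncomputable def affRep : Q3 →* AffineGroup Lam :=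
  QuotientGroup.lift _ affRepB3 (Subgroup.normalClosure_le_normal (by
    rintro r rfl
    rw [SetLike.mem_coe, MonoidHom.mem_ker, map_pow, map_mul, map_mul, affRepB3_σ1, affRepB3_σ2]
    exact affGen_sq (c := tUnit) tL_relation))

lemma affRep_q1 : affRep q1 = affGen tUnit 0 := affRepB3_σ1

lemma affRep_q2 : affRep q2 = affGen tUnit 1 := affRepB3_σ2

lemma affRep_right {w : Q3} (hw : w ∈ commutator Q3) : (affRep w).right = 1 :=
  MonoidHom.mem_ker.mp (Abelianization.commutator_subset_ker (A := Lamˣ)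
    ((SemidirectProduct.rightHom (φ := unitsMulAut Lam)).comp affRep) hw)

/-- The translation part of the affine representation, on the derived subgroup. -/
noncomputable def translationHom : ↥(commutator Q3) →* Multiplicative Lam where
  toFun w := (affRep w).left
  map_one' := by simp
  map_mul' v w := by simp [affRep_right v.2]

/-- The translation part of the affine representation, on the Alexander module. -/
noncomputable def alexTranslation : AlexMod Q3 →+ Lam :=
  MonoidHom.toAdditiveLeft (Abelianization.lift translationHom)

lemma alexTranslation_cls {w : Q3} (hw : w ∈ commutator Q3) :
    alexTranslation (cls hw) = (affRep w).left.toAdd := rfl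

lemma alexTranslation_cls_q : alexTranslation (cls q_mem) = 1 := by
  rw [alexTranslation_cls, map_mul, map_inv, affRep_q1, affRep_q2]
  simp [affGen]

lemma alexTranslation_tau (x : AlexMod Q3) :
    alexTranslation (tau q1 x) = tL * alexTranslation x := by
  obtain ⟨⟨w, hw⟩, rfl⟩ := QuotientGroup.mk_surjective x
  change alexTranslation (tau q1 (cls hw)) = tL * alexTranslation (cls hw)
  rw [tau_cls, alexTranslation_cls, alexTranslation_cls, map_mul, map_mul, map_inv, affRep_q1]
  simp [affGen, affRep_right hw, unitsMulAut_apply, tUnit]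

lemma alexTranslation_lamAction (r : Lam) :
    alexTranslation (lamAction r (cls q_mem)) = r := by
  induction r using lam_induction with
  | one => simp [alexTranslation_cls_q]
  | hadd r s hr hs =>
    rw [map_add]
    exact (map_add alexTranslation _ _).trans (congrArg₂ _ hr hs)
  | neg r hr =>
    rw [map_neg]
    exact (map_neg alexTranslation _).trans (congrArg _ hr)
  | mul r hr =>
    rw [map_mul, lamAction_tL]
    exact (alexTranslation_tau _).trans (congrArg _ hr)

lemma lamAction_surjective : Function.Surjective fun r : Lam => lamAction r (cls q_mem) := by
  let f : Lam →+ AlexMod Q3 := (AddMonoidHom.eval (cls q_mem)).comp lamAction.toAddMonoidHom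
  have : f.range = ⊤ := by
    refine addSubgroup_eq_top ⟨1, ?_⟩ ⟨tL, ?_⟩
    · change lamAction 1 _ = _
      simp
    · change lamAction tL _ = _
      rw [lamAction_tL, tauEnd_apply]
  exact AddMonoidHom.range_eq_top.mp this

end Sextics

/-- The Alexander module of `H = B₃/⟪(σ₁σ₂σ₁)²⟫` with distinguished element the image of
`σ₁`: the automorphism `τ` satisfies `τ² − τ + id = 0`, making `A(H, σ₁)` a module over
`Λ = ℤ[t]/(t² − t + 1)` with `t` acting as `τ`, and this module is free of rank `1`,
generated by the class of `σ₂σ₁⁻¹`. -/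
theorem alexander_module_B3_quotient :
    (∀ x : AlexMod Q3, tau q1 (tau q1 x) - tau q1 x + x = 0) ∧
    ∃ (h1 : q2 * q1⁻¹ ∈ commutator Q3) (inst : Module Lam (AlexMod Q3)),
      (∀ x : AlexMod Q3, smulOf inst tL x = tau q1 x) ∧
      Function.Bijective (fun v : Lam => smulOf inst v (cls h1)) := by
  refine ⟨fun x => DFunLike.congr_fun tauEnd_relation x, q_mem,
    Module.compHom _ lamAction, fun x => ?_, ?_, ?_⟩
  · exact DFunLike.congr_fun lamAction_tL x
  · exact Function.LeftInverse.injective alexTranslation_lamAction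
  · exact lamAction_surjective
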